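/- arXiv:2511.16240 — 2 statements merged into one kernel-verified Lean document; each statement's English description precedes it below -/
import Mathlib

section
/- The Fourier transform of a ↦ 1/J_a, where J_a = ∫_{-π/2}^{π/2} e^{2at} cos^{2k} t dt, satisfies F(b) = ∫_ℝ e^{-2πiab}/J_a da = (k + 1/2) cosh^{-2(k+1)}(πb) for all real b, for every integer k ≥ 1. -/
open MeasureTheory Real

/-- `J_a = ∫_{-π/2}^{π/2} e^{2at} cos^{2k} t dt`. -/
noncomputable def J (k : ℕ) (a : ℝ) : ℝ :=
  ∫ t in (-(π / 2))..(π / 2), Real.exp (2 * a * t) * Real.cos t ^ (2 * k)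

lemma J_rec (k : ℕ) (a : ℝ) :
    (4 * a ^ 2 + (2 * (k + 1) : ℝ) ^ 2) * J (k + 1) a = (2 * (k + 1)) * (2 * k + 1) * J k a := by
  have key : ∫ t in (-(π / 2))..(π / 2),
      ((4 * a ^ 2 + (2 * (k + 1) : ℝ) ^ 2) * (Real.exp (2 * a * t) * Real.cos t ^ (2 * (k + 1)))
        - (2 * (k + 1)) * (2 * k + 1) * (Real.exp (2 * a * t) * Real.cos t ^ (2 * k))) = 0 := by
    have hd : ∀ t ∈ Set.uIcc (-(π / 2)) (π / 2), HasDerivAt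
        (fun t : ℝ => Real.exp (2 * a * t) * (2 * a * Real.cos t ^ (2 * k + 2)
          + (2 * (k + 1)) * (Real.cos t ^ (2 * k + 1) * Real.sin t)))
        ((4 * a ^ 2 + (2 * (k + 1) : ℝ) ^ 2) * (Real.exp (2 * a * t) * Real.cos t ^ (2 * (k + 1)))
        - (2 * (k + 1)) * (2 * k + 1) * (Real.exp (2 * a * t) * Real.cos t ^ (2 * k))) t := by
      intro t _
      have h1 : HasDerivAt (fun t : ℝ => Real.exp (2 * a * t)) (Real.exp (2 * a * t) * (2 * a)) t := by
        simpa using ((hasDerivAt_id t).const_mul (2 * a)).exp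
      have hc := Real.hasDerivAt_cos t
      have h2 := hc.pow (2 * k + 2)
      have h3 := (hc.pow (2 * k + 1)).mul (Real.hasDerivAt_sin t)
      have h := h1.mul ((h2.const_mul (2 * a)).add (h3.const_mul (2 * ((k : ℝ) + 1))))
      refine h.congr_deriv ?_
      simp only [Pi.pow_apply, Pi.mul_apply, Pi.add_apply]
      have hs : Real.cos t ^ 2 = 1 - Real.sin t ^ 2 := Real.cos_sq' t
      have e1 : 2 * k + 2 - 1 = 2 * k + 1 := by omega
      have e2 : 2 * k + 1 - 1 = 2 * k := by omega
      rw [e1, e2]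
      push_cast
      have e3 : Real.cos t ^ (2 * (k + 1)) = Real.cos t ^ (2 * k) * (1 - Real.sin t ^ 2) := by
        rw [← hs]; ring
      have e4 : Real.cos t ^ (2 * k + 2) = Real.cos t ^ (2 * k) * (1 - Real.sin t ^ 2) := by
        rw [← hs]; ring
      have e5 : Real.cos t ^ (2 * k + 1) * Real.cos t = Real.cos t ^ (2 * k) * (1 - Real.sin t ^ 2) := by
        rw [← hs]; ring
      rw [e3, e4, e5]
      ring
    rw [intervalIntegral.integral_eq_sub_of_hasDerivAt hd]
    · simp
    · apply Continuous.intervalIntegrable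
      fun_prop
  rw [intervalIntegral.integral_sub, intervalIntegral.integral_const_mul,
    intervalIntegral.integral_const_mul] at key
  · unfold J
    linarith
  · apply Continuous.intervalIntegrable
    fun_prop
  · apply Continuous.intervalIntegrable
    fun_prop

lemma J_zero_mul (a : ℝ) : a * J 0 a = Real.sinh (π * a) := by
  unfold J
  rw [← intervalIntegral.integral_const_mul]
  have hd : ∀ t ∈ Set.uIcc (-(π / 2)) (π / 2), HasDerivAt
      (fun t : ℝ => Real.exp (2 * a * t) / 2)
      (a * (Real.exp (2 * a * t) * Real.cos t ^ (2 * 0))) t := by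
    intro t _
    have h1 : HasDerivAt (fun t : ℝ => Real.exp (2 * a * t)) (Real.exp (2 * a * t) * (2 * a)) t := by
      simpa using ((hasDerivAt_id t).const_mul (2 * a)).exp
    refine (h1.div_const 2).congr_deriv ?_
    simp; ring
  rw [intervalIntegral.integral_eq_sub_of_hasDerivAt hd, Real.sinh_eq]
  · rw [show 2 * a * (π / 2) = π * a by ring, show 2 * a * -(π / 2) = -(π * a) by ring]
    ring
  · apply Continuous.intervalIntegrable
    fun_prop

noncomputable def GG (k : ℕ) (a : ℝ) : ℂ :=
  Complex.Gamma (k + 1 - a * Complex.I) * Complex.Gamma (k + 1 + a * Complex.I)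

lemma GG_zero (a : ℝ) : GG 0 a * J 0 a = π := by
  by_cases ha : a = 0
  · subst ha
    simp [GG, J, Complex.Gamma_one]
  · have hJ : J 0 a = Real.sinh (π * a) / a := by
      rw [← J_zero_mul]; field_simp
    have hz : (a * Complex.I : ℂ) ≠ 0 := by simp [ha]
    have h1 : GG 0 a = a * Complex.I * (π / Complex.sin (π * (a * Complex.I))) := by
      rw [← Complex.Gamma_mul_Gamma_one_sub, GG]
      have := Complex.Gamma_add_one _ hz
      simp only [Nat.cast_zero, zero_add]
      rw [add_comm 1, this]; ring
    have hs : Real.sinh (π * a) ≠ 0 := by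
      rw [Ne, Real.sinh_eq_zero]; positivity
    have hs' : Complex.sinh (π * a) ≠ 0 := by exact_mod_cast hs
    rw [h1, hJ, ← mul_assoc, Complex.sin_mul_I]
    have ha' : (a : ℂ) ≠ 0 := by exact_mod_cast ha
    push_cast
    field_simp
    rw [mul_comm (a : ℂ) π]
    exact div_self hs'

lemma GG_succ (k : ℕ) (a : ℝ) : GG (k + 1) a = ((k + 1) ^ 2 + a ^ 2) * GG k a := by
  unfold GG
  have n1 : (k + 1 - a * Complex.I : ℂ) ≠ 0 := by
    intro h
    have := congrArg Complex.re h
    simp at this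
    linarith [(Nat.cast_nonneg k : (0 : ℝ) ≤ k)]
  have n2 : (k + 1 + a * Complex.I : ℂ) ≠ 0 := by
    intro h
    have := congrArg Complex.re h
    simp at this
    linarith [(Nat.cast_nonneg k : (0 : ℝ) ≤ k)]
  have h1 := Complex.Gamma_add_one _ n1
  have h2 := Complex.Gamma_add_one _ n2
  push_cast
  rw [show (k + 1 + 1 - a * Complex.I : ℂ) = k + 1 - a * Complex.I + 1 by ring,
    show (k + 1 + 1 + a * Complex.I : ℂ) = k + 1 + a * Complex.I + 1 by ring, h1, h2]
  linear_combination (-a ^ 2 * Complex.Gamma (k + 1 - a * Complex.I) * Complex.Gamma (k + 1 + a * Complex.I)) * Complex.I_sq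

lemma GG_J (k : ℕ) (a : ℝ) : 4 ^ k * GG k a * J k a = π * (2 * k).factorial := by
  induction k with
  | zero => simpa using GG_zero a
  | succ k ih =>
    have h := congrArg (fun x : ℝ => (x : ℂ)) (J_rec k a)
    push_cast at h
    rw [GG_succ, show 2 * (k + 1) = 2 * k + 1 + 1 by ring, Nat.factorial_succ, Nat.factorial_succ]
    push_cast
    linear_combination (4 ^ k * GG k a) * h + (2 * (k + 1)) * (2 * k + 1) * ih

lemma J_pos (k : ℕ) (a : ℝ) : 0 < J k a := by
  unfold J
  apply intervalIntegral.intervalIntegral_pos_of_pos_on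
  · apply Continuous.intervalIntegrable
    fun_prop
  · intro t ht
    have := Real.cos_pos_of_mem_Ioo ht
    positivity
  · linarith [Real.pi_pos]

lemma J_cont (k : ℕ) : Continuous (J k) := by
  unfold J
  apply intervalIntegral.continuous_parametric_intervalIntegral_of_continuous'
  fun_prop

lemma J_neg (k : ℕ) (a : ℝ) : J k (-a) = J k a := by
  unfold J
  rw [← neg_neg (π / 2), ← intervalIntegral.integral_comp_neg]
  simp

lemma cosh_lower (x : ℝ) : 1 + x ^ 2 / 2 ≤ Real.cosh x := by
  have h := Real.cosh_two_mul (x / 2)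
  rw [Real.cosh_sq, show 2 * (x / 2) = x by ring] at h
  have h2 : (x / 2) ^ 2 ≤ Real.sinh (x / 2) ^ 2 := by
    rw [sq_le_sq, Real.abs_sinh]
    exact Real.self_le_sinh_iff.2 (abs_nonneg _)
  nlinarith

lemma J_lower (k : ℕ) : ∃ c > 0, ∀ a, c * (1 + a ^ 2) ≤ J k a := by
  set B := ∫ t in (-(π / 2))..(π / 2), (2 * t ^ 2) * Real.cos t ^ (2 * k) with hB
  have hBpos : 0 < B := by
    have hi : ∀ u v : ℝ, IntervalIntegrable (fun t : ℝ => (2 * t ^ 2) * Real.cos t ^ (2 * k)) volume u v := by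
      intro u v
      apply Continuous.intervalIntegrable
      fun_prop
    rw [hB, ← intervalIntegral.integral_add_adjacent_intervals (hi _ 0) (hi 0 _)]
    apply add_pos_of_nonneg_of_pos
    · apply intervalIntegral.integral_nonneg
      · linarith [Real.pi_pos]
      · intro t _
        have : 0 ≤ Real.cos t ^ (2 * k) := by rw [pow_mul]; positivity
        positivity
    · apply intervalIntegral.intervalIntegral_pos_of_pos_on (hi _ _)
      · intro t ht
        have h1 := ht.1
        have := Real.cos_pos_of_mem_Ioo ⟨by linarith [Real.pi_pos], ht.2⟩
        positivity
      · linarith [Real.pi_pos]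
  have hmain : ∀ a, J k 0 + a ^ 2 * B ≤ J k a := by
    intro a
    have h2 : J k a = ∫ t in (-(π / 2))..(π / 2), Real.cosh (2 * a * t) * Real.cos t ^ (2 * k) := by
      have : J k a = (J k a + J k (-a)) / 2 := by rw [J_neg]; ring
      rw [this]
      unfold J
      rw [← intervalIntegral.integral_add, ← intervalIntegral.integral_div]
      · congr 1; ext t; rw [Real.cosh_eq]
        rw [show 2 * -a * t = -(2 * a * t) by ring]; ring
      · apply Continuous.intervalIntegrable
        fun_prop
      · apply Continuous.intervalIntegrable
        fun_prop
    rw [h2, hB, ← intervalIntegral.integral_const_mul]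
    unfold J
    rw [← intervalIntegral.integral_add]
    · apply intervalIntegral.integral_mono_on
      · linarith [Real.pi_pos]
      · apply Continuous.intervalIntegrable
        fun_prop
      · apply Continuous.intervalIntegrable
        have := Real.continuous_cosh
        fun_prop
      · intro t _
        have h3 : 0 ≤ Real.cos t ^ (2 * k) := by rw [pow_mul]; positivity
        have := mul_le_mul_of_nonneg_right (cosh_lower (2 * a * t)) h3
        simp
        nlinarith
    · apply Continuous.intervalIntegrable
      fun_prop
    · apply Continuous.intervalIntegrable
      fun_prop
  refine ⟨min (J k 0) B, lt_min (J_pos k 0) hBpos, fun a => ?_⟩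
  have := hmain a
  have h1 := min_le_left (J k 0) B
  have h2 := min_le_right (J k 0) B
  nlinarith [sq_nonneg a]

lemma inv_J_integrable (k : ℕ) : Integrable (fun a : ℝ => ((J k a : ℂ))⁻¹) := by
  obtain ⟨c, hc, h⟩ := J_lower k
  refine (integrable_inv_one_add_sq.const_mul c⁻¹).mono' ?_ ?_
  · apply Continuous.aestronglyMeasurable
    apply Continuous.inv₀
    · exact Complex.continuous_ofReal.comp (J_cont k)
    · intro a
      exact_mod_cast (J_pos k a).ne'
  · refine Filter.Eventually.of_forall fun a => ?_
    rw [norm_inv, Complex.norm_real, Real.norm_of_nonneg (J_pos k a).le, ← mul_inv]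
    apply inv_anti₀ (by positivity) (h a)

/-- the function whose transform is computed -/
noncomputable def ff (k : ℕ) (b : ℝ) : ℂ :=
  ((((k : ℝ) + 1 / 2) / Real.cosh (π * b) ^ (2 * (k + 1)) : ℝ) : ℂ)

lemma sig_mul (b : ℝ) : Real.sigmoid (2 * π * b) * (1 - Real.sigmoid (2 * π * b)) =
    1 / (4 * Real.cosh (π * b) ^ 2) := by
  have h : Real.exp (2 * π * b) = Real.exp (π * b) ^ 2 := by
    rw [← Real.exp_nat_mul]; congr 1; push_cast; ring
  rw [← Real.sigmoid_neg, Real.sigmoid_def, Real.sigmoid_def, neg_neg, Real.cosh_eq, Real.exp_neg,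
    Real.exp_neg, h]
  have := Real.exp_pos (π * b)
  field_simp
  ring

lemma sig_log (b : ℝ) : Real.log (Real.sigmoid (2 * π * b)) -
    Real.log (1 - Real.sigmoid (2 * π * b)) = 2 * π * b := by
  rw [← Real.sigmoid_neg, ← Real.sigmoid_mul_rexp_neg, Real.log_mul (Real.sigmoid_pos _).ne'
    (Real.exp_pos _).ne', Real.log_exp]
  ring

lemma cpow_aux (k : ℕ) (z : ℂ) (x : ℝ) (hx : 0 < x) :
    (x : ℂ) ^ (k + 1 + z - 1) = (x : ℂ) ^ k * Complex.exp (Real.log x * z) := by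
  have : (x : ℂ) ≠ 0 := by exact_mod_cast hx.ne'
  rw [show (k + 1 + z - 1 : ℂ) = k + z by ring, Complex.cpow_add _ _ this, Complex.cpow_natCast,
    Complex.cpow_def_of_ne_zero this, Complex.ofReal_log hx.le]

lemma integrand_eq (k : ℕ) (a b : ℝ) :
    |2 * π * (Real.sigmoid (2 * π * b) * (1 - Real.sigmoid (2 * π * b)))| •
      ((Real.sigmoid (2 * π * b) : ℂ) ^ (k + 1 + -(a * Complex.I) - 1) *
        (1 - (Real.sigmoid (2 * π * b) : ℂ)) ^ (k + 1 + a * Complex.I - 1)) =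
    (2 * π / (4 ^ (k + 1) * (k + 1 / 2)) : ℂ) *
      (Complex.exp (↑(-2 * π * b * a) * Complex.I) • ff k b) := by
  have p1 := Real.sigmoid_pos (2 * π * b)
  have p2 : 0 < 1 - Real.sigmoid (2 * π * b) := by linarith [Real.sigmoid_lt_one (2 * π * b)]
  have hl := sig_log b
  have hm := sig_mul b
  set s := Real.sigmoid (2 * π * b) with hs
  rw [cpow_aux k _ s p1, show (1 - (s : ℂ)) = ((1 - s : ℝ) : ℂ) by push_cast; rfl,
    cpow_aux k _ _ p2]
  rw [abs_of_pos (by have := Real.pi_pos; positivity), Complex.real_smul, smul_eq_mul]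
  have he : Complex.exp (Real.log s * -(a * Complex.I)) *
      Complex.exp (Real.log (1 - s) * (a * Complex.I)) =
      Complex.exp (↑(-2 * π * b * a) * Complex.I) := by
    rw [← Complex.exp_add]
    congr 1
    have := congrArg (fun x : ℝ => (x : ℂ)) hl
    push_cast at this ⊢
    linear_combination (-a * Complex.I) * this
  have hff : ff k b = ((k + 1 / 2 : ℂ)) * 4 ^ (k + 1) * (s * ((1 - s : ℝ) : ℂ)) ^ (k + 1) := by
    rw [← Complex.ofReal_mul, hm, ff]
    have := Real.cosh_pos (π * b)
    have h4 : ((k : ℝ) + 1 / 2) / Real.cosh (π * b) ^ (2 * (k + 1)) =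
        ((k : ℝ) + 1 / 2) * 4 ^ (k + 1) * (1 / (4 * Real.cosh (π * b) ^ 2)) ^ (k + 1) := by
      rw [div_pow, mul_pow, ← pow_mul, one_pow]
      field_simp
    rw [h4]
    push_cast
    rfl
  have hk : (k + 1 / 2 : ℂ) ≠ 0 := by
    have : ((k : ℝ) + 1 / 2) ≠ 0 := by positivity
    have h := Complex.ofReal_ne_zero.2 this
    push_cast at h
    exact h
  rw [hff, ← he]
  have h4 : (4 ^ (k + 1) : ℂ) ≠ 0 := pow_ne_zero _ (by norm_num)
  rw [mul_pow]
  generalize (k + 1 / 2 : ℂ) = q at *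
  push_cast
  field_simp
  ring

lemma deriv_phi (b : ℝ) : HasDerivAt (fun b => Real.sigmoid (2 * π * b))
    (2 * π * (Real.sigmoid (2 * π * b) * (1 - Real.sigmoid (2 * π * b)))) b := by
  have h := (hasDerivAt_sigmoid (2 * π * b)).comp b ((hasDerivAt_id b).const_mul (2 * π))
  refine h.congr_deriv ?_
  simp; ring

lemma inj_phi : Set.InjOn (fun b => Real.sigmoid (2 * π * b)) Set.univ := by
  intro x _ y _ h
  have := Real.sigmoid_injective h
  have hp := Real.pi_pos
  exact mul_left_cancel₀ (by positivity) this

lemma image_phi : (fun b => Real.sigmoid (2 * π * b)) '' Set.univ = Set.Ioo 0 1 := by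
  rw [← Real.range_sigmoid, Set.image_univ]
  have hp := Real.pi_pos
  have : Function.Surjective (fun b : ℝ => 2 * π * b) := fun y => ⟨y / (2 * π), by field_simp⟩
  exact this.range_comp Real.sigmoid

lemma re1 (k : ℕ) (a : ℝ) : 0 < (k + 1 + -(a * Complex.I) : ℂ).re := by
  simp; positivity

lemma re2 (k : ℕ) (a : ℝ) : 0 < (k + 1 + a * Complex.I : ℂ).re := by
  simp; positivity

lemma const_ne (k : ℕ) : (2 * π / (4 ^ (k + 1) * (k + 1 / 2)) : ℂ) ≠ 0 := by
  have hp := Real.pi_pos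
  have : (2 * π / (4 ^ (k + 1) * (k + 1 / 2)) : ℝ) ≠ 0 := by positivity
  have h := Complex.ofReal_ne_zero.2 this
  push_cast at h
  exact h

lemma ff_integrable (k : ℕ) : Integrable (ff k) := by
  have h := Complex.betaIntegral_convergent (re1 k 0) (re2 k 0)
  rw [intervalIntegrable_iff_integrableOn_Ioo_of_le zero_le_one, ← image_phi,
    integrableOn_image_iff_integrableOn_abs_deriv_smul MeasurableSet.univ
      (fun b _ => (deriv_phi b).hasDerivWithinAt) inj_phi, integrableOn_univ] at h
  simp_rw [integrand_eq] at h
  have h2 := h.const_mul (2 * π / (4 ^ (k + 1) * (k + 1 / 2)) : ℂ)⁻¹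
  simp_rw [inv_mul_cancel_left₀ (const_ne k)] at h2
  simpa using h2

open FourierTransform in
lemma ff_fourier (k : ℕ) (a : ℝ) : 𝓕 (ff k) a = ((J k a : ℂ))⁻¹ := by
  have h := Complex.Gamma_mul_Gamma_eq_betaIntegral (re1 k a) (re2 k a)
  rw [Complex.betaIntegral, intervalIntegral.integral_of_le zero_le_one,
    integral_Ioc_eq_integral_Ioo, ← image_phi,
    integral_image_eq_integral_abs_deriv_smul MeasurableSet.univ
      (fun b _ => (deriv_phi b).hasDerivWithinAt) inj_phi, setIntegral_univ] at h
  simp_rw [integrand_eq] at h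
  rw [integral_const_mul, ← fourier_real_eq_integral_exp_smul,
    show (k + 1 + -(a * Complex.I) + (k + 1 + a * Complex.I) : ℂ) = ((2 * k + 1 : ℕ) : ℂ) + 1 by
      push_cast; ring, Complex.Gamma_nat_eq_factorial, ← sub_eq_add_neg] at h
  have hG := GG_J k a
  rw [GG, h, Nat.factorial_succ] at hG
  have hJ : (J k a : ℂ) ≠ 0 := by exact_mod_cast (J_pos k a).ne'
  have hk : (2 * k + 1 : ℂ) ≠ 0 := by
    have : (2 * (k : ℝ) + 1) ≠ 0 := by positivity
    exact_mod_cast this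
  have hk2 : (k + 1 / 2 : ℂ) ≠ 0 := by
    have : ((k : ℝ) + 1 / 2) ≠ 0 := by positivity
    have h := Complex.ofReal_ne_zero.2 this
    push_cast at h
    exact h
  have hf : ((2 * k).factorial : ℂ) ≠ 0 := by exact_mod_cast Nat.factorial_ne_zero _
  have hp : (π : ℂ) ≠ 0 := by exact_mod_cast Real.pi_ne_zero
  apply eq_inv_of_mul_eq_one_left
  apply mul_left_cancel₀ (mul_ne_zero hp hf)
  rw [mul_one]
  refine Eq.trans ?_ hG
  have e : (k + 1 / 2 : ℂ) = (2 * k + 1) / 2 := by ring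
  rw [e]
  push_cast
  field_simp
  ring

lemma ff_cont (k : ℕ) : Continuous (ff k) := by
  unfold ff
  apply Complex.continuous_ofReal.comp
  apply Continuous.div continuous_const
  · have := Real.continuous_cosh
    fun_prop
  · intro b
    have := Real.cosh_pos (π * b)
    positivity

open FourierTransform in
lemma main_aux (k : ℕ) (b : ℝ) :
    (∫ a : ℝ, Complex.exp (-2 * π * Complex.I * a * b) / (J k a : ℂ)) = ff k b := by
  have hF : 𝓕 (ff k) = fun a => ((J k a : ℂ))⁻¹ := funext (ff_fourier k)
  have h := (ff_cont k).fourierInv_fourier_eq (ff_integrable k) (by rw [hF]; exact inv_J_integrable k)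
  have h2 := congrFun h (-b)
  rw [Real.fourierInv_eq_fourier_neg, neg_neg, hF, fourier_real_eq_integral_exp_smul] at h2
  have h3 : ff k (-b) = ff k b := by simp [ff]
  rw [← h3, ← h2]
  congr 1
  ext a
  rw [smul_eq_mul, div_eq_mul_inv]
  congr 2
  push_cast
  ring

/-- The Fourier transform of `a ↦ 1/J_a` is
`F(b) = (k+1/2) cosh^{-2(k+1)}(πb)` for all real `b` and every `k ≥ 1`. -/
theorem stmt_8 (k : ℕ) (hk : 1 ≤ k) (b : ℝ) :
    (∫ a : ℝ, Complex.exp (-2 * π * Complex.I * a * b) / (J k a : ℂ)) =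
      ((((k : ℝ) + 1 / 2) / Real.cosh (π * b) ^ (2 * (k + 1)) : ℝ) : ℂ) := by
  exact main_aux k b
end

section
/- F(0) = ∫_{-∞}^{∞} da / J_a = k + 1/2, where J_a = ∫_{-π/2}^{π/2} e^{2at} cos^{2k} t dt and k ≥ 1 is an integer. -/
open MeasureTheory Real

/-- The function `(σ (1 - σ))^(k+1)`, i.e. a power of `sech²`. -/
noncomputable def fS (k : ℕ) (x : ℝ) : ℂ :=
  (((sigmoid x * (1 - sigmoid x)) ^ (k + 1) : ℝ) : ℂ)

/-- `Γ(k+1-ib) Γ(k+1+ib)`. -/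
noncomputable def WG (k : ℕ) (b : ℝ) : ℂ :=
  Complex.Gamma ((k : ℂ) + 1 - b * Complex.I) * Complex.Gamma ((k : ℂ) + 1 + b * Complex.I)

lemma log_sigmoid_sub (x : ℝ) : Real.log (sigmoid x) - Real.log (1 - sigmoid x) = x := by
  have h1 := sigmoid_pos x
  have h2 : 0 < 1 - sigmoid x := by linarith [sigmoid_lt_one x]
  have h := sigmoid_mul_rexp_neg x
  rw [sigmoid_neg] at h
  rw [← h, Real.log_mul h1.ne' (Real.exp_pos _).ne', Real.log_exp]
  ring

lemma beta_pointwise (k : ℕ) (b x : ℝ) :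
    |sigmoid x * (1 - sigmoid x)| • (((sigmoid x : ℝ) : ℂ) ^ ((k : ℂ) + 1 - b * Complex.I - 1) *
      (1 - ((sigmoid x : ℝ) : ℂ)) ^ ((k : ℂ) + 1 + b * Complex.I - 1))
    = Complex.exp (-(b * x : ℝ) * Complex.I) * fS k x := by
  have h1 := sigmoid_pos x
  have h2 : 0 < 1 - sigmoid x := by linarith [sigmoid_lt_one x]
  have hx := log_sigmoid_sub x
  unfold fS
  generalize sigmoid x = s at *
  have h1' : (s : ℂ) ≠ 0 := by exact_mod_cast h1.ne'
  have h2' : ((1 - s : ℝ) : ℂ) ≠ 0 := by exact_mod_cast h2.ne'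
  rw [abs_of_pos (mul_pos h1 h2)]
  have e2 : (1 - (s : ℂ)) = ((1 - s : ℝ) : ℂ) := by push_cast; rfl
  have e3 : (k : ℂ) + 1 - b * Complex.I - 1 = k + (-(b * Complex.I)) := by ring
  have e4 : (k : ℂ) + 1 + b * Complex.I - 1 = k + b * Complex.I := by ring
  rw [e2, e3, e4, Complex.cpow_add _ _ h1', Complex.cpow_add _ _ h2', Complex.cpow_natCast,
    Complex.cpow_natCast, Complex.cpow_def_of_ne_zero h1', Complex.cpow_def_of_ne_zero h2',
    ← Complex.ofReal_log h1.le, ← Complex.ofReal_log h2.le]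
  have e5 : Complex.exp (-(b * x : ℝ) * Complex.I) =
      Complex.exp ((Real.log s : ℂ) * -(b * Complex.I)) *
        Complex.exp ((Real.log (1 - s) : ℂ) * (b * Complex.I)) := by
    rw [← Complex.exp_add]
    congr 1
    rw [← hx]
    push_cast
    ring
  rw [e5, Complex.real_smul]
  push_cast
  rw [mul_pow]
  ring

lemma sigmoid_image : sigmoid '' Set.univ = Set.Ioo 0 1 := by
  rw [Set.image_univ, range_sigmoid]

lemma fourier_beta (k : ℕ) (b : ℝ) :
    ∫ x : ℝ, Complex.exp (-(b * x : ℝ) * Complex.I) * fS k x =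
      Complex.betaIntegral ((k : ℂ) + 1 - b * Complex.I) ((k : ℂ) + 1 + b * Complex.I) := by
  unfold Complex.betaIntegral
  rw [intervalIntegral.integral_of_le zero_le_one, integral_Ioc_eq_integral_Ioo,
    ← sigmoid_image,
    integral_image_eq_integral_abs_deriv_smul MeasurableSet.univ
      (fun x _ => (hasDerivAt_sigmoid x).hasDerivWithinAt) sigmoid_injective.injOn,
    setIntegral_univ]
  simp only [beta_pointwise]

lemma fS_cont (k : ℕ) : Continuous (fS k) := by
  unfold fS
  have := continuous_sigmoid
  fun_prop

lemma fS_int (k : ℕ) : Integrable (fS k) := by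
  have h := Complex.betaIntegral_convergent (u := (k : ℂ) + 1 - (0 : ℝ) * Complex.I)
    (v := (k : ℂ) + 1 + (0 : ℝ) * Complex.I) (by simp; positivity) (by simp; positivity)
  rw [intervalIntegrable_iff_integrableOn_Ioo_of_le zero_le_one, ← sigmoid_image,
    integrableOn_image_iff_integrableOn_abs_deriv_smul MeasurableSet.univ
      (fun x _ => (hasDerivAt_sigmoid x).hasDerivWithinAt) sigmoid_injective.injOn,
    integrableOn_univ] at h
  refine h.congr (Filter.Eventually.of_forall fun x => ?_)
  simp only [beta_pointwise]
  simp

lemma WG_eq (k : ℕ) (b : ℝ) :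
    WG k b = ((2 * k + 1).factorial : ℂ) *
      ∫ x : ℝ, Complex.exp (-(b * x : ℝ) * Complex.I) * fS k x := by
  rw [fourier_beta, WG, Complex.Gamma_mul_Gamma_eq_betaIntegral (by simp; positivity)
    (by simp; positivity), ← Complex.Gamma_nat_eq_factorial]
  congr 2
  push_cast
  ring

lemma WG_succ (k : ℕ) (b : ℝ) :
    WG (k + 1) b = (((k + 1 : ℝ) ^ 2 + b ^ 2 : ℝ) : ℂ) * WG k b := by
  have p : (0:ℝ) < (k:ℝ) + 1 := by positivity
  have h1 : (k : ℂ) + 1 - b * Complex.I ≠ 0 := by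
    intro h; have := congrArg Complex.re h; simp at this; linarith
  have h2 : (k : ℂ) + 1 + b * Complex.I ≠ 0 := by
    intro h; have := congrArg Complex.re h; simp at this; linarith
  unfold WG
  have e1 : ((k + 1 : ℕ) : ℂ) + 1 - b * Complex.I = ((k : ℂ) + 1 - b * Complex.I) + 1 := by
    push_cast; ring
  have e2 : ((k + 1 : ℕ) : ℂ) + 1 + b * Complex.I = ((k : ℂ) + 1 + b * Complex.I) + 1 := by
    push_cast; ring
  rw [e1, e2, Complex.Gamma_add_one _ h1, Complex.Gamma_add_one _ h2]
  push_cast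
  linear_combination (-(b:ℂ)^2 * Complex.Gamma ((k : ℂ) + 1 - b * Complex.I) *
    Complex.Gamma ((k : ℂ) + 1 + b * Complex.I)) * Complex.I_sq

lemma WG_zero (a : ℝ) : WG 0 a * (Real.sinh (π * a) : ℂ) = π * a := by
  by_cases ha : a = 0
  · subst ha; simp
  have hz : (a : ℂ) * Complex.I ≠ 0 := by simp [ha]
  have hs : (Real.sinh (π * a) : ℂ) ≠ 0 := by
    have : π * a ≠ 0 := mul_ne_zero pi_ne_zero ha
    exact_mod_cast (by simpa [Real.sinh_eq_zero] using this)
  have h := Complex.Gamma_mul_Gamma_one_sub ((a : ℂ) * Complex.I)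
  have e : (π : ℂ) * (a * Complex.I) = ((π * a : ℝ) : ℂ) * Complex.I := by push_cast; ring
  rw [e, Complex.sin_mul_I, ← Complex.ofReal_sinh] at h
  unfold WG
  have e1 : ((0 : ℕ) : ℂ) + 1 + a * Complex.I = a * Complex.I + 1 := by push_cast; ring
  have e2 : ((0 : ℕ) : ℂ) + 1 - a * Complex.I = 1 - a * Complex.I := by push_cast; ring
  rw [e1, e2, Complex.Gamma_add_one _ hz]
  calc _ = (a * Complex.I) * (Complex.Gamma (a * Complex.I) * Complex.Gamma (1 - a * Complex.I))
        * (Real.sinh (π * a) : ℂ) := by ring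
    _ = _ := by
      rw [h]
      have := Complex.I_ne_zero
      field_simp

lemma J_zero (a : ℝ) (ha : a ≠ 0) : J 0 a = Real.sinh (π * a) / a := by
  unfold J
  have : ∀ t ∈ Set.uIcc (-(π / 2)) (π / 2), HasDerivAt (fun t => Real.exp (2 * a * t) / (2 * a))
      (Real.exp (2 * a * t) * Real.cos t ^ (2 * 0)) t := by
    intro t _
    have h := ((((hasDerivAt_id t).const_mul (2 * a))).exp).div_const (2 * a)
    refine h.congr_deriv ?_
    simp
    field_simp
  rw [intervalIntegral.integral_eq_sub_of_hasDerivAt this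
    ((by fun_prop : Continuous _).intervalIntegrable _ _), Real.sinh_eq]
  have e1 : 2 * a * (π / 2) = π * a := by ring
  have e2 : 2 * a * (-(π / 2)) = -(π * a) := by ring
  rw [e1, e2]
  field_simp

lemma J_succ (k : ℕ) (a : ℝ) :
    4 * ((k + 1 : ℝ) ^ 2 + a ^ 2) * J (k + 1) a = (2 * k + 2) * (2 * k + 1) * J k a := by
  have hd : ∀ t ∈ Set.uIcc (-(π / 2)) (π / 2), HasDerivAt
      (fun t => Real.exp (2 * a * t) * (2 * a * Real.cos t ^ (2 * k + 2) +
        (2 * k + 2) * Real.cos t ^ (2 * k + 1) * Real.sin t))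
      (4 * ((k + 1 : ℝ) ^ 2 + a ^ 2) * (Real.exp (2 * a * t) * Real.cos t ^ (2 * (k + 1))) -
        (2 * k + 2) * (2 * k + 1) * (Real.exp (2 * a * t) * Real.cos t ^ (2 * k))) t := by
    intro t _
    have h := ((((hasDerivAt_id t).const_mul (2 * a))).exp).mul
      ((((Real.hasDerivAt_cos t).pow (2 * k + 2)).const_mul (2 * a)).add
        ((((Real.hasDerivAt_cos t).pow (2 * k + 1)).const_mul (2 * (k : ℝ) + 2)).mul
          (Real.hasDerivAt_sin t)))
    refine h.congr_deriv ?_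
    simp
    have hs := Real.sin_sq_add_cos_sq t
    linear_combination (-(2 * k + 2) * (2 * k + 1) * Real.exp (2 * a * t) *
      Real.cos t ^ (2 * k)) * hs
  have hi := intervalIntegral.integral_eq_sub_of_hasDerivAt hd
    ((by fun_prop : Continuous _).intervalIntegrable _ _)
  rw [intervalIntegral.integral_sub ((by fun_prop : Continuous _).intervalIntegrable _ _)
    ((by fun_prop : Continuous _).intervalIntegrable _ _), intervalIntegral.integral_const_mul,
    intervalIntegral.integral_const_mul] at hi
  simp at hi
  unfold J
  linarith

lemma J_mul_WG (k : ℕ) (a : ℝ) (ha : a ≠ 0) :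
    (J k a : ℂ) * WG k a = π * (2 * k).factorial / 4 ^ k := by
  induction k with
  | zero =>
    rw [J_zero a ha]
    have := WG_zero a
    have ha' : (a : ℂ) ≠ 0 := by exact_mod_cast ha
    push_cast at this ⊢
    simp
    field_simp
    linear_combination this
  | succ k ih =>
    have h := congrArg (fun x : ℝ => (x : ℂ)) (J_succ k a)
    have hw := WG_succ k a
    have e : 2 * (k + 1) = (2 * k + 1) + 1 := by ring
    rw [e, Nat.factorial_succ, Nat.factorial_succ, pow_succ]
    push_cast at h hw ⊢
    rw [hw]
    field_simp at ih ⊢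
    linear_combination (4 : ℂ) ^ k * WG k a * h + (2 * k + 2) * (2 * k + 1) * ih

lemma WG_bound (k : ℕ) : ∃ C : ℝ, ∀ b : ℝ, ‖WG k b‖ ≤ C * (1 + b ^ 2)⁻¹ := by
  refine ⟨((2 * (k + 1) + 1).factorial : ℝ) * ∫ x, ‖fS (k + 1) x‖, fun b => ?_⟩
  have h1 : ‖WG (k + 1) b‖ ≤ ((2 * (k + 1) + 1).factorial : ℝ) * ∫ x, ‖fS (k + 1) x‖ := by
    rw [WG_eq, norm_mul, Complex.norm_natCast]
    gcongr
    refine (norm_integral_le_integral_norm _).trans (le_of_eq ?_)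
    congr 1 with x
    rw [norm_mul, ← Complex.ofReal_neg, Complex.norm_exp_ofReal_mul_I, one_mul]
  rw [WG_succ, norm_mul, Complex.norm_real, Real.norm_of_nonneg (by positivity)] at h1
  rw [← div_eq_mul_inv, le_div_iff₀ (by positivity), mul_comm]
  refine le_trans ?_ h1
  gcongr
  have : (0:ℝ) ≤ k := by positivity
  nlinarith

open FourierTransform in
lemma fourier_fS (k : ℕ) (w : ℝ) :
    𝓕 (fS k) w = (((2 * k + 1).factorial : ℂ))⁻¹ * WG k (2 * π * w) := by
  have : (((2 * k + 1).factorial : ℂ)) ≠ 0 := by exact_mod_cast Nat.factorial_ne_zero _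
  rw [WG_eq, inv_mul_cancel_left₀ this, Real.fourier_real_eq_integral_exp_smul]
  congr 1 with x
  rw [smul_eq_mul]
  congr 2
  push_cast
  ring

lemma WG_cont (k : ℕ) : Continuous (WG k) := by
  unfold WG
  rw [continuous_iff_continuousAt]
  intro b
  have key : ∀ s : ℂ, 0 < s.re → ContinuousAt Complex.Gamma s := fun s hs =>
    (Complex.differentiableAt_Gamma s (fun m h => by
      rw [h] at hs; simp at hs; have : (0:ℝ) ≤ m := by positivity
      linarith)).continuousAt
  refine ContinuousAt.mul (ContinuousAt.comp (f := fun b : ℝ => (k : ℂ) + 1 - b * Complex.I)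
    (key _ (by simp; positivity)) (by fun_prop))
    (ContinuousAt.comp (f := fun b : ℝ => (k : ℂ) + 1 + b * Complex.I)
    (key _ (by simp; positivity)) (by fun_prop))

lemma WG_int (k : ℕ) : Integrable (WG k) := by
  obtain ⟨C, hC⟩ := WG_bound k
  exact (integrable_inv_one_add_sq.const_mul C).mono' (WG_cont k).aestronglyMeasurable
    (Filter.Eventually.of_forall hC)

open FourierTransform in
lemma WG_integral (k : ℕ) :
    ∫ b : ℝ, WG k b = 2 * π * (2 * k + 1).factorial / 4 ^ (k + 1) := by
  have hF : (𝓕 (fS k) : ℝ → ℂ) = fun w => (((2 * k + 1).factorial : ℂ))⁻¹ * WG k (2 * π * w) :=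
    funext (fourier_fS k)
  have hi : Integrable (𝓕 (fS k) : ℝ → ℂ) := by
    rw [hF]
    exact ((WG_int k).comp_mul_left' (by positivity)).const_mul _
  have h := (fS_int k).fourierInv_fourier_eq hi (v := 0) (fS_cont k).continuousAt
  rw [Real.fourierInv_eq', hF] at h
  simp only [inner_zero_right, mul_zero, Complex.ofReal_zero, zero_mul, Complex.exp_zero,
    one_smul] at h
  rw [integral_const_mul, Measure.integral_comp_mul_left (fun b => WG k b)] at h
  have hf : fS k 0 = 1 / 4 ^ (k + 1) := by
    unfold fS
    rw [sigmoid_zero]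
    norm_num [div_pow]
  rw [hf, abs_of_pos (by positivity), Complex.real_smul] at h
  have : (((2 * k + 1).factorial : ℂ)) ≠ 0 := by exact_mod_cast Nat.factorial_ne_zero _
  have hp : (π : ℂ) ≠ 0 := by exact_mod_cast pi_ne_zero
  push_cast at h
  field_simp at h ⊢
  linear_combination h

/-- `F(0) = ∫_ℝ da/J_a = k + 1/2`. -/
theorem stmt_9 (k : ℕ) (hk : 1 ≤ k) :
    (∫ a : ℝ, 1 / J k a) = (k : ℝ) + 1 / 2 := by
  have hp : (π : ℂ) ≠ 0 := by exact_mod_cast pi_ne_zero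
  have hf : (((2 * k).factorial : ℂ)) ≠ 0 := by exact_mod_cast Nat.factorial_ne_zero _
  have h0 : ∀ᵐ a : ℝ, a ≠ 0 := by simp [ae_iff]
  have h : (∫ a : ℝ, ((1 / J k a : ℝ) : ℂ)) =
      ∫ a : ℝ, (4 ^ k / (π * (2 * k).factorial) : ℂ) * WG k a := by
    refine integral_congr_ae ?_
    filter_upwards [h0] with a ha
    have := J_mul_WG k a ha
    have hJ : (J k a : ℂ) ≠ 0 := by
      intro h
      rw [h, zero_mul] at this
      have h4 : (π * (2 * k).factorial / 4 ^ k : ℂ) ≠ 0 := div_ne_zero (mul_ne_zero hp hf) (pow_ne_zero _ (by norm_num))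
      exact h4 this.symm
    push_cast
    field_simp at this ⊢
    linear_combination -this
  rw [integral_const_mul, WG_integral, integral_complex_ofReal, Nat.factorial_succ, pow_succ] at h
  have : ((∫ a : ℝ, 1 / J k a : ℝ) : ℂ) = (((k : ℝ) + 1 / 2 : ℝ) : ℂ) := by
    rw [h]
    push_cast
    field_simp
    ring
  exact_mod_cast this
end
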